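/- Let {X_n, n≥1} be a φ-mixing sequence of random variables with common marginal distribution function F, and let F_n be the empirical distribution function. Then for any fixed x ∈ ℝ, any t > 0, any 0 < β < 1 with m = ⌈n^β⌉, and any n ≥ 2, P(|F_n(x) − F(x)| > t) ≤ 2e C_1 exp{−n t² / (2 C_2 (2 + n^β t))}, where C_1 = exp{2e n^{1−β} φ(m)} and C_2 = 4[1 + 4 Σ_{i=1}^{2m} φ^{1/2}(i)]. -/

import Mathlib

open MeasureTheory Filter Set

/-- The σ-algebra generated by the random variables `X i` for `i ∈ S`. -/
noncomputable def sigmaGen {Ω : Type*} (X : ℕ → Ω → ℝ) (S : Set ℕ) : MeasurableSpace Ω :=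
  ⨆ i ∈ S, MeasurableSpace.comap (X i) inferInstance

/-- The φ-mixing coefficients of the sequence `X` with respect to the measure `μ`:
`φ(n) = sup_{k ≥ 1} sup { |P(B|A) - P(B)| : A ∈ σ(X_i, 1 ≤ i ≤ k), P(A) > 0,
B ∈ σ(X_i, i ≥ k + n) }`. -/
noncomputable def phiCoef {Ω : Type*} [MeasurableSpace Ω] (X : ℕ → Ω → ℝ)
    (μ : Measure Ω) (n : ℕ) : ℝ :=
  sSup {r : ℝ | ∃ k : ℕ, 1 ≤ k ∧ ∃ A B : Set Ω,
    MeasurableSet[sigmaGen X {i | 1 ≤ i ∧ i ≤ k}] A ∧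
    MeasurableSet[sigmaGen X {i | k + n ≤ i}] B ∧
    0 < μ A ∧
    r = |(μ (A ∩ B)).toReal / (μ A).toReal - (μ B).toReal|}

/-- The empirical distribution function `F_n(x) = n⁻¹ ∑_{i=1}^n I(X_i ≤ x)`. -/
noncomputable def empDF {Ω : Type*} (X : ℕ → Ω → ℝ) (n : ℕ) (ω : Ω) (x : ℝ) : ℝ :=
  (n : ℝ)⁻¹ * ∑ i ∈ Finset.Icc 1 n, (if X i ω ≤ x then (1 : ℝ) else 0)

/-- The `p`-th quantile `F⁻¹(p) = inf {x : F(x) ≥ p}` of a distribution function `F`. -/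
noncomputable def quantile (F : ℝ → ℝ) (p : ℝ) : ℝ :=
  sInf {x : ℝ | p ≤ F x}

/-- The sample `p`-th quantile `ξ_{p,n} = F_n⁻¹(p) = inf {x : F_n(x) ≥ p}`. -/
noncomputable def sampleQuantile {Ω : Type*} (X : ℕ → Ω → ℝ) (n : ℕ) (ω : Ω) (p : ℝ) : ℝ :=
  sInf {x : ℝ | p ≤ empDF X n ω x}

/-- The `j`-th block of length `m` of the index set `{1, …, n}`. -/
def indexBlock (m n j : ℕ) : Finset ℕ :=
  Finset.Ioc (j * m) (j * m + m) ∩ Finset.Icc 1 n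

theorem mem_indexBlock {m n j i : ℕ} :
    i ∈ indexBlock m n j ↔ (j * m < i ∧ i ≤ j * m + m) ∧ 1 ≤ i ∧ i ≤ n := by
  simp [indexBlock]

theorem sum_indexBlock_even_add_odd (f : ℕ → ℝ) (m n K : ℕ) :
    ∑ j ∈ Finset.range K, ∑ i ∈ indexBlock m n (2 * j), f i +
      ∑ j ∈ Finset.range K, ∑ i ∈ indexBlock m n (2 * j + 1), f i =
    ∑ i ∈ Finset.Ioc 0 (2 * K * m) ∩ Finset.Icc 1 n, f i := by
  induction K with
  | zero => simp
  | succ K ih =>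
    have hunion : Finset.Ioc 0 (2 * (K + 1) * m) ∩ Finset.Icc 1 n =
        (Finset.Ioc 0 (2 * K * m) ∩ Finset.Icc 1 n) ∪
          (indexBlock m n (2 * K) ∪ indexBlock m n (2 * K + 1)) := by
      have h1 : 2 * (K + 1) * m = 2 * K * m + m + m := by ring
      have h2 : (2 * K + 1) * m = 2 * K * m + m := by ring
      ext i
      simp only [Finset.mem_union, mem_indexBlock, Finset.mem_inter, Finset.mem_Ioc,
        Finset.mem_Icc, h1, h2]
      omega
    have h2 : (2 * K + 1) * m = 2 * K * m + m := by ring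
    rw [hunion, Finset.sum_union, Finset.sum_union, ← ih, Finset.sum_range_succ,
      Finset.sum_range_succ]
    · ring
    · rw [Finset.disjoint_left]
      intro i
      simp only [mem_indexBlock, h2]
      omega
    · rw [Finset.disjoint_left]
      intro i
      simp only [Finset.mem_union, mem_indexBlock, Finset.mem_inter, Finset.mem_Ioc,
        Finset.mem_Icc, h2]
      omega

theorem exp_mul_add_le (l u v : ℝ) :
    Real.exp (l * (u + v)) ≤ (Real.exp (2 * l * u) + Real.exp (2 * l * v)) / 2 := by
  have h : ∀ w, Real.exp (2 * l * w) = Real.exp (l * w) ^ 2 := fun w => by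
    rw [← Real.exp_nat_mul]
    push_cast
    ring_nf
  rw [h, h, mul_add, Real.exp_add]
  linarith [two_mul_le_add_sq (Real.exp (l * u)) (Real.exp (l * v))]

theorem sigmaGen_mono {Ω : Type*} {X : ℕ → Ω → ℝ} {S T : Set ℕ} (h : S ⊆ T) :
    sigmaGen X S ≤ sigmaGen X T :=
  biSup_mono h

theorem measurable_sigmaGen {Ω : Type*} {X : ℕ → Ω → ℝ} {S : Set ℕ} {i : ℕ} (hi : i ∈ S) :
    Measurable[sigmaGen X S] (X i) :=
  measurable_iff_comap_le.2 (le_iSup₂_of_le i hi le_rfl)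

/-- If `μ(A ∩ B) ≤ (μ B + φ) μ A` for all `A ∈ m₁`, `B ∈ m₂`, then
`E[Y Z] ≤ E[Y] (E[Z] + φ M)` for nonnegative `Y ∈ m₁` and `Z ∈ m₂` with `Z ≤ M`. -/
theorem integral_mul_le_of_measureReal_inter_le {Ω : Type*} {m₁ m₂ m₀ : MeasurableSpace Ω}
    {μ : Measure Ω} [IsProbabilityMeasure μ] (h₁ : m₁ ≤ m₀) (h₂ : m₂ ≤ m₀)
    {φ : ℝ} (hφ : 0 ≤ φ)
    (h : ∀ A B, MeasurableSet[m₁] A → MeasurableSet[m₂] B →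
      μ.real (A ∩ B) ≤ (μ.real B + φ) * μ.real A)
    {Y Z : Ω → ℝ} (hY : Measurable[m₁] Y) (hZ : Measurable[m₂] Z) (hY0 : ∀ ω, 0 ≤ Y ω)
    (hYi : Integrable Y μ) (hZ0 : ∀ ω, 0 ≤ Z ω) {M : ℝ} (hZM : ∀ ω, Z ω ≤ M) :
    ∫ ω, Y ω * Z ω ∂μ ≤ (∫ ω, Y ω ∂μ) * (∫ ω, Z ω ∂μ + φ * M) := by
  obtain ⟨ω₀⟩ : Nonempty Ω := nonempty_of_isProbabilityMeasure μ
  have hM : 0 ≤ M := (hZ0 ω₀).trans (hZM ω₀)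
  have hY' : Measurable Y := hY.mono h₁ le_rfl
  have hZ' : Measurable Z := hZ.mono h₂ le_rfl
  have hZi : Integrable Z μ := Integrable.of_bound hZ'.aestronglyMeasurable M
    (ae_of_all _ fun ω => by rw [Real.norm_eq_abs, abs_of_nonneg (hZ0 ω)]; exact hZM ω)
  set y : Ω → ENNReal := fun ω => ENNReal.ofReal (Y ω) with hy
  have hym : Measurable[m₁] y := ENNReal.measurable_ofReal.comp hY
  have hset : ∀ B, MeasurableSet[m₂] B →
      ∫⁻ ω in B, y ω ∂μ ≤ (μ B + ENNReal.ofReal φ) * ∫⁻ ω, y ω ∂μ := by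
    intro B hB
    have hle : (μ.restrict B).trim h₁ ≤ ((μ B + ENNReal.ofReal φ) • μ).trim h₁ := by
      refine Measure.le_iff.2 fun A hA => ?_
      rw [trim_measurableSet_eq h₁ hA, trim_measurableSet_eq h₁ hA,
        Measure.restrict_apply (h₁ _ hA), Measure.smul_apply, smul_eq_mul,
        ← ofReal_measureReal, ← ofReal_measureReal (s := B), ← ofReal_measureReal (s := A),
        ← ENNReal.ofReal_add measureReal_nonneg hφ,
        ← ENNReal.ofReal_mul (add_nonneg measureReal_nonneg hφ)]
      exact ENNReal.ofReal_le_ofReal (h A B hA hB)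
    calc ∫⁻ ω in B, y ω ∂μ = ∫⁻ ω, y ω ∂((μ.restrict B).trim h₁) := (lintegral_trim h₁ hym).symm
      _ ≤ ∫⁻ ω, y ω ∂(((μ B + ENNReal.ofReal φ) • μ).trim h₁) := lintegral_mono' hle le_rfl
      _ = _ := by rw [lintegral_trim h₁ hym, lintegral_smul_measure, smul_eq_mul]
  have hym' : Measurable y := hym.mono h₁ le_rfl
  have hIoc : ∀ ν : Measure Ω, ∫⁻ ω, ENNReal.ofReal (Z ω) ∂ν =
      ∫⁻ t in Ioc 0 M, ν {ω | t < Z ω} := by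
    intro ν
    rw [lintegral_eq_lintegral_meas_lt ν (ae_of_all _ hZ0) hZ'.aemeasurable]
    rw [← Ioc_union_Ioi_eq_Ioi hM, lintegral_union measurableSet_Ioi
      (Set.disjoint_left.2 fun a ha hb => not_lt.2 ha.2 hb)]
    have : ∫⁻ t in Ioi M, ν {ω | t < Z ω} = 0 := by
      rw [setLIntegral_congr_fun (g := fun _ => 0) measurableSet_Ioi]
      · simp
      · intro t ht
        have : {ω | t < Z ω} = ∅ := by
          ext ω
          simpa using (hZM ω).trans (le_of_lt ht)
        simp [this]
    rw [this, add_zero]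
  have key : ∫⁻ ω, y ω * ENNReal.ofReal (Z ω) ∂μ ≤
      (∫⁻ ω, y ω ∂μ) * (∫⁻ ω, ENNReal.ofReal (Z ω) ∂μ + ENNReal.ofReal (φ * M)) := by
    have hmeas : Measurable fun t : ℝ => μ {ω | t < Z ω} :=
      Antitone.measurable fun a b hab => measure_mono fun ω (hω : b < Z ω) => hab.trans_lt hω
    calc ∫⁻ ω, y ω * ENNReal.ofReal (Z ω) ∂μ
        = ∫⁻ ω, ENNReal.ofReal (Z ω) ∂(μ.withDensity y) :=
          (lintegral_withDensity_eq_lintegral_mul _ hym' hZ'.ennreal_ofReal).symm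
      _ = ∫⁻ t in Ioc 0 M, (μ.withDensity y) {ω | t < Z ω} := hIoc _
      _ ≤ ∫⁻ t in Ioc 0 M, (μ {ω | t < Z ω} + ENNReal.ofReal φ) * ∫⁻ ω, y ω ∂μ := by
          refine lintegral_mono fun t => ?_
          have hB : MeasurableSet[m₂] {ω | t < Z ω} :=
            hZ measurableSet_Ioi
          rw [withDensity_apply _ (h₂ _ hB)]
          exact hset _ hB
      _ = (∫⁻ t in Ioc 0 M, μ {ω | t < Z ω} + ENNReal.ofReal φ) * ∫⁻ ω, y ω ∂μ :=
          lintegral_mul_const _ (hmeas.add_const _)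
      _ = _ := by
          rw [lintegral_add_left hmeas, ← hIoc μ, mul_comm, lintegral_const,
            Measure.restrict_apply_univ, Real.volume_Ioc, sub_zero, ENNReal.ofReal_mul hφ]
  have hYint := ofReal_integral_eq_lintegral_ofReal hYi (ae_of_all _ hY0)
  have hZint := ofReal_integral_eq_lintegral_ofReal hZi (ae_of_all _ hZ0)
  have hYZi : Integrable (fun ω => Y ω * Z ω) μ :=
    hYi.mul_bdd (c := M) hZ'.aestronglyMeasurable
      (ae_of_all _ fun ω => by rw [Real.norm_eq_abs, abs_of_nonneg (hZ0 ω)]; exact hZM ω)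
  have hYZint := ofReal_integral_eq_lintegral_ofReal hYZi
    (ae_of_all _ fun ω => mul_nonneg (hY0 ω) (hZ0 ω))
  have hI : 0 ≤ ∫ ω, Y ω ∂μ := integral_nonneg hY0
  have hJ : 0 ≤ ∫ ω, Z ω ∂μ := integral_nonneg hZ0
  have hR : 0 ≤ (∫ ω, Y ω ∂μ) * (∫ ω, Z ω ∂μ + φ * M) := by positivity
  rw [← ENNReal.ofReal_le_ofReal_iff hR, ENNReal.ofReal_mul hI,
    ENNReal.ofReal_add hJ (by positivity), hYint, hZint, hYZint]
  simpa only [ENNReal.ofReal_mul (hY0 _)] using key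

/-- The indicator of `X i ≤ x`, centred at `c`. -/
noncomputable def centredIndicator {Ω : Type*} (X : ℕ → Ω → ℝ) (x c : ℝ) (i : ℕ) (ω : Ω) : ℝ :=
  (if X i ω ≤ x then (1 : ℝ) else 0) - c

theorem abs_centredIndicator_le {Ω : Type*} {X : ℕ → Ω → ℝ} {x c : ℝ} (hc0 : 0 ≤ c) (hc1 : c ≤ 1)
    (i : ℕ) (ω : Ω) : |centredIndicator X x c i ω| ≤ 1 := by
  unfold centredIndicator
  split_ifs <;> rw [abs_le] <;> constructor <;> linarith

theorem measurable_centredIndicator {Ω : Type*} {X : ℕ → Ω → ℝ} {S : Set ℕ} {i : ℕ} (hi : i ∈ S)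
    (x c : ℝ) : Measurable[sigmaGen X S] (centredIndicator X x c i) := by
  have h : MeasurableSet[sigmaGen X S] {ω | X i ω ≤ x} :=
    measurable_sigmaGen hi measurableSet_Iic
  let := sigmaGen X S
  exact (Measurable.ite h measurable_const measurable_const).sub_const c

theorem abs_sum_centredIndicator_le {Ω : Type*} {X : ℕ → Ω → ℝ} {c : ℝ} (hc0 : 0 ≤ c)
    (hc1 : c ≤ 1) (x : ℝ) (B : Finset ℕ) (ω : Ω) :
    |∑ i ∈ B, centredIndicator X x c i ω| ≤ B.card := by
  calc |∑ i ∈ B, centredIndicator X x c i ω| ≤ ∑ i ∈ B, |centredIndicator X x c i ω| :=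
        Finset.abs_sum_le_sum_abs _ _
    _ ≤ ∑ _i ∈ B, (1 : ℝ) := Finset.sum_le_sum fun i _ => abs_centredIndicator_le hc0 hc1 i ω
    _ = B.card := by simp

theorem measurable_sum_centredIndicator {Ω : Type*} {X : ℕ → Ω → ℝ} {S : Set ℕ} {B : Finset ℕ}
    (hB : ∀ i ∈ B, i ∈ S) (x c : ℝ) :
    Measurable[sigmaGen X S] fun ω => ∑ i ∈ B, centredIndicator X x c i ω := by
  let := sigmaGen X S
  exact Finset.measurable_fun_sum B fun i hi => measurable_centredIndicator (hB i hi) x c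

section Mixing

variable {Ω : Type*} [MeasurableSpace Ω] {μ : Measure Ω} {X : ℕ → Ω → ℝ}

theorem sigmaGen_le (hX : ∀ i, Measurable (X i)) (S : Set ℕ) :
    sigmaGen X S ≤ ‹MeasurableSpace Ω› :=
  iSup₂_le fun i _ => (hX i).comap_le

theorem phiCoef_nonneg (n : ℕ) : 0 ≤ phiCoef X μ n := by
  refine Real.sSup_nonneg ?_
  rintro r ⟨k, -, A, B, -, -, -, rfl⟩
  exact abs_nonneg _

theorem abs_cond_sub_le_one [IsProbabilityMeasure μ] (A B : Set Ω) :
    |(μ (A ∩ B)).toReal / (μ A).toReal - (μ B).toReal| ≤ 1 := by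
  have h1 : (μ (A ∩ B)).toReal / (μ A).toReal ≤ 1 :=
    div_le_one_of_le₀ (measureReal_mono (μ := μ) inter_subset_left) ENNReal.toReal_nonneg
  have h2 : 0 ≤ (μ (A ∩ B)).toReal / (μ A).toReal := by positivity
  have h3 : (μ B).toReal ≤ 1 := measureReal_le_one (μ := μ)
  have h4 : 0 ≤ (μ B).toReal := ENNReal.toReal_nonneg
  rw [abs_le]
  constructor <;> linarith

theorem phiCoef_le_one [IsProbabilityMeasure μ] (n : ℕ) : phiCoef X μ n ≤ 1 := by
  refine Real.sSup_le ?_ zero_le_one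
  rintro r ⟨k, -, A, B, -, -, -, rfl⟩
  exact abs_cond_sub_le_one A B

/-- The defining inequality of the mixing coefficient, cleared of its denominator. The past may
be trivial, in which case the future is arbitrary. -/
theorem measureReal_inter_le_phiCoef [IsProbabilityMeasure μ] {k n : ℕ} {T : Set ℕ}
    (hT : k = 0 ∨ T ⊆ {i | k + n ≤ i}) {A B : Set Ω}
    (hA : MeasurableSet[sigmaGen X {i | 1 ≤ i ∧ i ≤ k}] A) (hB : MeasurableSet[sigmaGen X T] B) :
    μ.real (A ∩ B) ≤ (μ.real B + phiCoef X μ n) * μ.real A := by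
  have hφ := phiCoef_nonneg (X := X) (μ := μ) n
  rcases Nat.eq_zero_or_pos k with rfl | hk
  · have hbot : sigmaGen X {i | 1 ≤ i ∧ i ≤ 0} = ⊥ := by
      have : {i : ℕ | 1 ≤ i ∧ i ≤ 0} = ∅ := by ext i; simp; omega
      rw [this]; simp [sigmaGen]
    rw [hbot, MeasurableSpace.measurableSet_bot_iff] at hA
    rcases hA with rfl | rfl
    · simp
    · simpa using hφ
  · rcases eq_or_ne (μ A) 0 with h0 | h0
    · have : μ (A ∩ B) = 0 := measure_mono_null inter_subset_left h0
      simp [measureReal_def, h0, this]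
    · have hT' : T ⊆ {i | k + n ≤ i} := hT.resolve_left hk.ne'
      have hpos : 0 < μ.real A := ENNReal.toReal_pos h0 (measure_ne_top _ _)
      have hle : |(μ (A ∩ B)).toReal / (μ A).toReal - (μ B).toReal| ≤ phiCoef X μ n := by
        refine le_csSup ⟨1, ?_⟩
          ⟨k, hk, A, B, hA, sigmaGen_mono hT' _ hB, pos_iff_ne_zero.2 h0, rfl⟩
        rintro r ⟨k, -, A, B, -, -, -, rfl⟩
        exact abs_cond_sub_le_one A B
      have h := (abs_le.1 hle).2
      rw [← div_le_iff₀ hpos]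
      simp only [measureReal_def]
      linarith

theorem integrable_exp_mul_of_abs_le [IsFiniteMeasure μ] {W : Ω → ℝ} (hW : Measurable W)
    {C : ℝ} (hC : ∀ ω, |W ω| ≤ C) (s : ℝ) : Integrable (fun ω => Real.exp (s * W ω)) μ := by
  refine .of_bound (C := Real.exp (|s| * C))
    (Real.measurable_exp.comp (hW.const_mul s)).aestronglyMeasurable (ae_of_all _ fun ω => ?_)
  rw [Real.norm_eq_abs, Real.abs_exp, Real.exp_le_exp]
  refine (le_abs_self _).trans ?_
  rw [abs_mul]
  exact mul_le_mul_of_nonneg_left (hC ω) (abs_nonneg s)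

/-- A bounded centred random variable has moment generating function at most `1 + s² E[W²]`
in the range `|s W| ≤ 1`. -/
theorem integral_exp_mul_le_one_add [IsProbabilityMeasure μ] {W : Ω → ℝ} (hW : Measurable W)
    {s C : ℝ} (hC : ∀ ω, |W ω| ≤ C) (hs : ∀ ω, |s * W ω| ≤ 1) (h0 : ∫ ω, W ω ∂μ = 0) :
    ∫ ω, Real.exp (s * W ω) ∂μ ≤ 1 + s ^ 2 * ∫ ω, W ω ^ 2 ∂μ := by
  have hWi : Integrable W μ := .of_bound hW.aestronglyMeasurable C (ae_of_all _ hC)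
  have hW2 : Integrable (fun ω => W ω ^ 2) μ :=
    .of_bound (hW.pow_const 2).aestronglyMeasurable (C ^ 2) (ae_of_all _ fun ω => by
      rw [norm_pow]
      exact pow_le_pow_left₀ (norm_nonneg _) (hC ω) 2)
  have h1 : Integrable (fun ω => 1 + s * W ω) μ := (integrable_const 1).add (hWi.const_mul s)
  have hi : Integrable (fun ω => 1 + s * W ω + s ^ 2 * W ω ^ 2) μ :=
    h1.add (hW2.const_mul _)
  calc ∫ ω, Real.exp (s * W ω) ∂μ ≤ ∫ ω, (1 + s * W ω + s ^ 2 * W ω ^ 2) ∂μ := by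
        refine integral_mono_of_nonneg (ae_of_all _ fun ω => (Real.exp_pos _).le) hi
          (ae_of_all _ fun ω => ?_)
        have := (abs_le.1 (Real.abs_exp_sub_one_sub_id_le (hs ω))).2
        simp only
        nlinarith
    _ = 1 + s ^ 2 * ∫ ω, W ω ^ 2 ∂μ := by
        rw [integral_add h1 (hW2.const_mul _),
          integral_add (integrable_const 1) (hWi.const_mul s), integral_const_mul,
          integral_const_mul, h0]
        simp

theorem integral_ite_le (hX : ∀ i, Measurable (X i)) (x : ℝ) (i : ℕ) :
    ∫ ω, (if X i ω ≤ x then (1 : ℝ) else 0) ∂μ = μ.real {ω | X i ω ≤ x} := by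
  have h : MeasurableSet {ω | X i ω ≤ x} := hX i measurableSet_Iic
  rw [← integral_indicator_one h]
  rfl

theorem integrable_ite_le [IsFiniteMeasure μ] (hX : ∀ i, Measurable (X i)) (x : ℝ) (i : ℕ) :
    Integrable (fun ω => if X i ω ≤ x then (1 : ℝ) else 0) μ :=
  .of_bound (Measurable.ite (hX i measurableSet_Iic) measurable_const
    measurable_const).aestronglyMeasurable 1 (ae_of_all _ fun ω => by split_ifs <;> simp)

theorem integrable_centredIndicator [IsFiniteMeasure μ] (hX : ∀ i, Measurable (X i)) (x c : ℝ)
    (i : ℕ) : Integrable (centredIndicator X x c i) μ :=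
  (integrable_ite_le hX x i).sub (integrable_const c)

theorem integral_centredIndicator [IsProbabilityMeasure μ] (hX : ∀ i, Measurable (X i)) {x c : ℝ}
    {i : ℕ} (hi : c = μ.real {ω | X i ω ≤ x}) : ∫ ω, centredIndicator X x c i ω ∂μ = 0 := by
  unfold centredIndicator
  rw [integral_sub (integrable_ite_le hX x i) (integrable_const c), integral_ite_le hX, hi]
  simp

theorem integral_centredIndicator_mul_le [IsProbabilityMeasure μ] (hX : ∀ i, Measurable (X i))
    {x c : ℝ} {i j : ℕ} (h1 : 1 ≤ i) (hij : i < j) (hi : c = μ.real {ω | X i ω ≤ x})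
    (hj : c = μ.real {ω | X j ω ≤ x}) :
    ∫ ω, centredIndicator X x c i ω * centredIndicator X x c j ω ∂μ ≤ phiCoef X μ (j - i) := by
  have hmix : μ.real ({ω | X i ω ≤ x} ∩ {ω | X j ω ≤ x}) ≤
      (μ.real {ω | X j ω ≤ x} + phiCoef X μ (j - i)) * μ.real {ω | X i ω ≤ x} :=
    measureReal_inter_le_phiCoef (T := {l | i + (j - i) ≤ l}) (k := i) (.inr Subset.rfl)
      (measurable_sigmaGen (X := X) (S := {l | 1 ≤ l ∧ l ≤ i}) ⟨h1, le_rfl⟩ measurableSet_Iic)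
      (measurable_sigmaGen (X := X) (S := {l | i + (j - i) ≤ l}) (i := j) (by simp; omega)
        measurableSet_Iic)
  rw [← hi, ← hj] at hmix
  have hc1 : c ≤ 1 := hi ▸ measureReal_le_one
  have hφ := phiCoef_nonneg (X := X) (μ := μ) (j - i)
  have hmeas : MeasurableSet ({ω | X i ω ≤ x} ∩ {ω | X j ω ≤ x}) :=
    (hX i measurableSet_Iic).inter (hX j measurableSet_Iic)
  have hint : Integrable (({ω | X i ω ≤ x} ∩ {ω | X j ω ≤ x}).indicator (1 : Ω → ℝ)) μ :=
    (integrable_const (1 : ℝ)).indicator hmeas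
  have heq : ∀ ω, centredIndicator X x c i ω * centredIndicator X x c j ω =
      ({ω | X i ω ≤ x} ∩ {ω | X j ω ≤ x}).indicator (1 : Ω → ℝ) ω
        - c * centredIndicator X x c i ω - c * (if X j ω ≤ x then (1 : ℝ) else 0) := by
    intro ω
    by_cases hi : X i ω ≤ x <;> by_cases hj : X j ω ≤ x <;>
      simp [centredIndicator, hi, hj, indicator] <;> ring
  have hη := integrable_centredIndicator (μ := μ) hX x c i
  have hsub : Integrable (fun ω => ({ω | X i ω ≤ x} ∩ {ω | X j ω ≤ x}).indicator (1 : Ω → ℝ) ω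
      - c * centredIndicator X x c i ω) μ := hint.sub (hη.const_mul c)
  simp_rw [heq]
  rw [integral_sub hsub ((integrable_ite_le hX x j).const_mul c),
    integral_sub hint (hη.const_mul c), integral_const_mul, integral_const_mul,
    integral_ite_le hX, ← hj, integral_centredIndicator hX hi, integral_indicator_one hmeas]
  nlinarith

/-- The variance of a block of length at most `m`. -/
theorem integral_sq_sum_centredIndicator_le [IsProbabilityMeasure μ]
    (hX : ∀ i, Measurable (X i)) {x c : ℝ} (hc : ∀ i, 1 ≤ i → c = μ.real {ω | X i ω ≤ x})
    {B : Finset ℕ} {a m : ℕ} (hB : B ⊆ Finset.Ioc a (a + m)) :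
    ∫ ω, (∑ i ∈ B, centredIndicator X x c i ω) ^ 2 ∂μ ≤
      B.card * (1 + 4 * ∑ i ∈ Finset.Icc 1 (2 * m), Real.sqrt (phiCoef X μ i)) := by
  have hc0 : 0 ≤ c := hc 1 le_rfl ▸ measureReal_nonneg
  have hc1 : c ≤ 1 := hc 1 le_rfl ▸ measureReal_le_one
  set η := centredIndicator X x c with hη
  have hη1 : ∀ i ω, |η i ω| ≤ 1 := abs_centredIndicator_le hc0 hc1
  have hηm : ∀ i, Measurable (η i) := fun i =>
    (measurable_centredIndicator (mem_univ i) x c).mono (sigmaGen_le hX univ) le_rfl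
  have hint : ∀ i j, Integrable (fun ω => η i ω * η j ω) μ := fun i j =>
    .of_bound ((hηm i).mul (hηm j)).aestronglyMeasurable 1 (ae_of_all _ fun ω => by
      rw [norm_mul]
      exact mul_le_one₀ (hη1 i ω) (norm_nonneg _) (hη1 j ω))
  set D := ∑ i ∈ Finset.Icc 1 (2 * m), Real.sqrt (phiCoef X μ i) with hD
  have hsqrt : ∀ d, phiCoef X μ d ≤ Real.sqrt (phiCoef X μ d) := fun d =>
    Real.le_sqrt_of_sq_le (by
      have h0 := phiCoef_nonneg (X := X) (μ := μ) d
      have h1 := phiCoef_le_one (X := X) (μ := μ) d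
      nlinarith)
  have hD0 : 0 ≤ D := Finset.sum_nonneg fun i _ => Real.sqrt_nonneg _
  have hpos : ∀ i ∈ B, a < i ∧ i ≤ a + m := fun i hi => Finset.mem_Ioc.1 (hB hi)
  have hrow : ∀ i ∈ B, ∑ j ∈ B, ∫ ω, η i ω * η j ω ∂μ ≤ 1 + 4 * D := by
    intro i hi
    have hinj : ∀ (s : Finset ℕ) (g : ℕ → ℕ), Set.InjOn g s →
        (∀ j ∈ s, g j ∈ Finset.Icc 1 (2 * m)) → (∀ j ∈ s, ∫ ω, η i ω * η j ω ∂μ ≤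
          phiCoef X μ (g j)) → ∑ j ∈ s, ∫ ω, η i ω * η j ω ∂μ ≤ D := by
      intro s g hg hmem hle
      calc ∑ j ∈ s, ∫ ω, η i ω * η j ω ∂μ ≤ ∑ j ∈ s, Real.sqrt (phiCoef X μ (g j)) :=
            Finset.sum_le_sum fun j hj => (hle j hj).trans (hsqrt _)
        _ = ∑ d ∈ s.image g, Real.sqrt (phiCoef X μ d) :=
          (Finset.sum_image (f := fun d => Real.sqrt (phiCoef X μ d)) hg).symm
        _ ≤ D := Finset.sum_le_sum_of_subset_of_nonneg
            (Finset.image_subset_iff.2 hmem) fun _ _ _ => Real.sqrt_nonneg _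
    have hlt : ∑ j ∈ B with j < i, ∫ ω, η i ω * η j ω ∂μ ≤ D := by
      refine hinj _ (fun j => i - j) ?_ ?_ ?_
      · intro j hj l hl h
        simp only [Finset.mem_coe, Finset.mem_filter] at hj hl h
        omega
      · intro j hj
        rw [Finset.mem_filter] at hj
        have h1 := hpos i hi
        have h2 := hpos j hj.1
        simp only [Finset.mem_Icc]
        omega
      · intro j hj
        rw [Finset.mem_filter] at hj
        have h1 := hpos j hj.1
        simp_rw [mul_comm (η i _)]
        exact integral_centredIndicator_mul_le hX (by omega) hj.2 (hc _ (by omega))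
          (hc _ (by omega))
    have hgt : ∑ j ∈ B with i < j, ∫ ω, η i ω * η j ω ∂μ ≤ D := by
      refine hinj _ (fun j => j - i) ?_ ?_ ?_
      · intro j hj l hl h
        simp only [Finset.mem_coe, Finset.mem_filter] at hj hl h
        omega
      · intro j hj
        rw [Finset.mem_filter] at hj
        have h1 := hpos i hi
        have h2 := hpos j hj.1
        simp only [Finset.mem_Icc]
        omega
      · intro j hj
        rw [Finset.mem_filter] at hj
        have h1 := hpos i hi
        exact integral_centredIndicator_mul_le hX (by omega) hj.2 (hc _ (by omega))
          (hc _ (by omega))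
    have hdiag : ∫ ω, η i ω * η i ω ∂μ ≤ 1 := by
      calc ∫ ω, η i ω * η i ω ∂μ ≤ ∫ _, (1 : ℝ) ∂μ :=
            integral_mono (hint i i) (integrable_const 1) fun ω => by
              simpa [← sq] using hη1 i ω
        _ = 1 := by simp
    have hsplit : B = insert i ({j ∈ B | j < i} ∪ {j ∈ B | i < j}) := by
      ext j
      simp only [Finset.mem_insert, Finset.mem_union, Finset.mem_filter]
      constructor
      · intro hj
        rcases lt_trichotomy j i with h | h | h <;> tauto
      · rintro (rfl | h | h) <;> tauto
    rw [hsplit, Finset.sum_insert (by simp), Finset.sum_union]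
    · linarith
    · rw [Finset.disjoint_left]
      intro j hj hl
      simp only [Finset.mem_filter] at hj hl
      omega
  calc ∫ ω, (∑ i ∈ B, η i ω) ^ 2 ∂μ = ∑ i ∈ B, ∑ j ∈ B, ∫ ω, η i ω * η j ω ∂μ := by
        simp_rw [sq, Finset.sum_mul_sum]
        rw [integral_finsetSum _ fun i _ => integrable_finsetSum _ fun j _ => hint i j]
        exact Finset.sum_congr rfl fun i _ => integral_finsetSum _ fun j _ => hint i j
    _ ≤ ∑ i ∈ B, (1 + 4 * D) := Finset.sum_le_sum hrow
    _ = B.card * (1 + 4 * D) := by rw [Finset.sum_const, nsmul_eq_mul]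

/-- The moment generating function of a sum over every second block. -/
theorem integral_exp_sum_indexBlock_le [IsProbabilityMeasure μ]
    (hX : ∀ i, Measurable (X i)) {x c : ℝ} (hc : ∀ i, 1 ≤ i → c = μ.real {ω | X i ω ≤ x})
    {m n : ℕ} (r : ℕ) {s : ℝ} (hs : |s| * m ≤ 1) (J : ℕ) :
    ∫ ω, Real.exp (s * ∑ j ∈ Finset.range J, ∑ i ∈ indexBlock m n (2 * j + r),
        centredIndicator X x c i ω) ∂μ ≤
      Real.exp (s ^ 2 * (1 + 4 * ∑ i ∈ Finset.Icc 1 (2 * m), Real.sqrt (phiCoef X μ i)) *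
          (∑ j ∈ Finset.range J, ((indexBlock m n (2 * j + r)).card : ℝ)) +
        J * (phiCoef X μ m * Real.exp 1)) := by
  have hc0 : 0 ≤ c := hc 1 le_rfl ▸ measureReal_nonneg
  have hc1 : c ≤ 1 := hc 1 le_rfl ▸ measureReal_le_one
  have hφ := phiCoef_nonneg (X := X) (μ := μ) m
  set D := 1 + 4 * ∑ i ∈ Finset.Icc 1 (2 * m), Real.sqrt (phiCoef X μ i) with hD
  induction J with
  | zero => simp
  | succ J ih =>
    set B := indexBlock m n (2 * J + r) with hB
    set W : Ω → ℝ := fun ω => ∑ i ∈ B, centredIndicator X x c i ω with hW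
    set V : Ω → ℝ := fun ω => ∑ j ∈ Finset.range J, ∑ i ∈ indexBlock m n (2 * j + r),
      centredIndicator X x c i ω with hV
    have hcard : (B.card : ℝ) ≤ m := by
      have : B.card ≤ (Finset.Ioc ((2 * J + r) * m) ((2 * J + r) * m + m)).card :=
        Finset.card_le_card Finset.inter_subset_left
      simpa using this
    have hWB : ∀ ω, |W ω| ≤ B.card := abs_sum_centredIndicator_le hc0 hc1 x B
    have hsW : ∀ ω, |s * W ω| ≤ 1 := fun ω => by
      rw [abs_mul]
      exact (mul_le_mul_of_nonneg_left ((hWB ω).trans hcard) (abs_nonneg s)).trans hs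
    set k := (2 * J + r) * m - m with hk
    have hT : k = 0 ∨ {i | (2 * J + r) * m < i} ⊆ {i | k + m ≤ i} := by
      by_cases h : k = 0
      · exact .inl h
      · refine .inr fun i (hi : _ < i) => ?_
        change k + m ≤ i
        omega
    have hVm : Measurable[sigmaGen X {i | 1 ≤ i ∧ i ≤ k}] V := by
      let := sigmaGen X {i | 1 ≤ i ∧ i ≤ k}
      refine Finset.measurable_fun_sum _ fun j hj => measurable_sum_centredIndicator ?_ x c
      intro i hi
      rw [mem_indexBlock] at hi
      have hle : (2 * j + r + 2) * m ≤ (2 * J + r) * m :=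
        Nat.mul_le_mul_right m (by have := Finset.mem_range.1 hj; omega)
      have heq : (2 * j + r + 2) * m = (2 * j + r) * m + m + m := by ring
      refine ⟨hi.2.1, ?_⟩
      omega
    have hWm : Measurable[sigmaGen X {i | (2 * J + r) * m < i}] W :=
      measurable_sum_centredIndicator (fun i hi => (mem_indexBlock.1 hi).1.1) x c
    have hVb : ∀ ω, |V ω| ≤ ∑ j ∈ Finset.range J, ((indexBlock m n (2 * j + r)).card : ℝ) :=
      fun ω => (Finset.abs_sum_le_sum_abs _ _).trans
        (Finset.sum_le_sum fun j _ => abs_sum_centredIndicator_le hc0 hc1 x _ ω)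
    have hYm : Measurable[sigmaGen X {i | 1 ≤ i ∧ i ≤ k}] fun ω => Real.exp (s * V ω) :=
      Real.measurable_exp.comp (hVm.const_mul s)
    have hZm : Measurable[sigmaGen X {i | (2 * J + r) * m < i}] fun ω => Real.exp (s * W ω) :=
      Real.measurable_exp.comp (hWm.const_mul s)
    have hYi : Integrable (fun ω => Real.exp (s * V ω)) μ :=
      integrable_exp_mul_of_abs_le (hVm.mono (sigmaGen_le hX _) le_rfl) hVb s
    have hstep := integral_mul_le_of_measureReal_inter_le (μ := μ) (sigmaGen_le hX _)
      (sigmaGen_le hX _) hφ (fun A B hA hB => measureReal_inter_le_phiCoef hT hA hB) hYm hZm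
      (fun ω => (Real.exp_pos _).le) hYi (fun ω => (Real.exp_pos _).le) (M := Real.exp 1)
      (fun ω => Real.exp_le_exp.2 ((le_abs_self _).trans (hsW ω)))
    have hmean : ∫ ω, W ω ∂μ = 0 := by
      simp only [hW]
      rw [integral_finsetSum _ fun i _ => integrable_centredIndicator hX x c i]
      exact Finset.sum_eq_zero fun i hi =>
        integral_centredIndicator hX (hc i (mem_indexBlock.1 hi).2.1)
    have hmgf := integral_exp_mul_le_one_add (μ := μ) (hWm.mono (sigmaGen_le hX _) le_rfl)
      hWB hsW hmean
    have hvar : ∫ ω, W ω ^ 2 ∂μ ≤ B.card * D :=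
      integral_sq_sum_centredIndicator_le hX hc (m := m) Finset.inter_subset_left
    have hfac : ∫ ω, Real.exp (s * W ω) ∂μ + phiCoef X μ m * Real.exp 1 ≤
        Real.exp (s ^ 2 * D * B.card + phiCoef X μ m * Real.exp 1) := by
      have h1 := Real.add_one_le_exp (s ^ 2 * D * B.card + phiCoef X μ m * Real.exp 1)
      have h2 := mul_le_mul_of_nonneg_left hvar (sq_nonneg s)
      linarith
    have hpos : 0 ≤ ∫ ω, Real.exp (s * W ω) ∂μ + phiCoef X μ m * Real.exp 1 :=
      add_nonneg (integral_nonneg fun ω => (Real.exp_pos _).le)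
        (mul_nonneg hφ (Real.exp_pos _).le)
    calc ∫ ω, Real.exp (s * ∑ j ∈ Finset.range (J + 1), ∑ i ∈ indexBlock m n (2 * j + r),
          centredIndicator X x c i ω) ∂μ
        = ∫ ω, Real.exp (s * V ω) * Real.exp (s * W ω) ∂μ := by
          simp only [Finset.sum_range_succ, mul_add, Real.exp_add, hV, hW, hB]
      _ ≤ _ := hstep
      _ ≤ _ := mul_le_mul ih hfac hpos (Real.exp_pos _).le
      _ = _ := by
          rw [← Real.exp_add, Finset.sum_range_succ, ← hB]
          push_cast
          congr 1
          ring

/-- The moment generating function of the full sum, split by convexity into its even and odd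
blocks. -/
theorem integral_exp_sum_centredIndicator_le [IsProbabilityMeasure μ]
    (hX : ∀ i, Measurable (X i)) {x c : ℝ} (hc : ∀ i, 1 ≤ i → c = μ.real {ω | X i ω ≤ x})
    {m n K : ℕ} (hK : n ≤ 2 * K * m) {l : ℝ} (hl : |2 * l| * m ≤ 1) :
    ∫ ω, Real.exp (l * ∑ i ∈ Finset.Icc 1 n, centredIndicator X x c i ω) ∂μ ≤
      Real.exp (4 * l ^ 2 * (1 + 4 * ∑ i ∈ Finset.Icc 1 (2 * m), Real.sqrt (phiCoef X μ i)) * n +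
        K * (phiCoef X μ m * Real.exp 1)) := by
  have hc0 : 0 ≤ c := hc 1 le_rfl ▸ measureReal_nonneg
  have hc1 : c ≤ 1 := hc 1 le_rfl ▸ measureReal_le_one
  have hall : Finset.Ioc 0 (2 * K * m) ∩ Finset.Icc 1 n = Finset.Icc 1 n := by
    ext i
    simp only [Finset.mem_inter, Finset.mem_Ioc, Finset.mem_Icc]
    omega
  have hsplit : ∀ f : ℕ → ℝ, ∑ j ∈ Finset.range K, ∑ i ∈ indexBlock m n (2 * j), f i +
      ∑ j ∈ Finset.range K, ∑ i ∈ indexBlock m n (2 * j + 1), f i =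
      ∑ i ∈ Finset.Icc 1 n, f i := fun f => by
    rw [sum_indexBlock_even_add_odd, hall]
  set D := 1 + 4 * ∑ i ∈ Finset.Icc 1 (2 * m), Real.sqrt (phiCoef X μ i) with hD
  have hD0 : 0 ≤ D := add_nonneg zero_le_one
    (mul_nonneg zero_le_four (Finset.sum_nonneg fun i _ => Real.sqrt_nonneg _))
  clear_value D
  have hcards : ∑ j ∈ Finset.range K, ((indexBlock m n (2 * j)).card : ℝ) +
      ∑ j ∈ Finset.range K, ((indexBlock m n (2 * j + 1)).card : ℝ) = n := by
    simpa using hsplit fun _ => 1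
  have hbound : ∀ r, ∑ j ∈ Finset.range K, ((indexBlock m n (2 * j + r)).card : ℝ) ≤ n →
      ∫ ω, Real.exp (2 * l * ∑ j ∈ Finset.range K, ∑ i ∈ indexBlock m n (2 * j + r),
        centredIndicator X x c i ω) ∂μ ≤
        Real.exp (4 * l ^ 2 * D * n + K * (phiCoef X μ m * Real.exp 1)) := by
    intro r hle
    refine (integral_exp_sum_indexBlock_le hX hc r hl K).trans (Real.exp_le_exp.2 ?_)
    rw [← hD, show (2 * l) ^ 2 = 4 * l ^ 2 by ring]
    have := mul_le_mul_of_nonneg_left hle (by positivity : 0 ≤ 4 * l ^ 2 * D)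
    linarith
  have hodd : 0 ≤ ∑ j ∈ Finset.range K, ((indexBlock m n (2 * j + 1)).card : ℝ) :=
    Finset.sum_nonneg fun _ _ => Nat.cast_nonneg _
  have heven : 0 ≤ ∑ j ∈ Finset.range K, ((indexBlock m n (2 * j)).card : ℝ) :=
    Finset.sum_nonneg fun _ _ => Nat.cast_nonneg _
  have h0 := hbound 0 (by simp only [add_zero]; linarith)
  have h1 := hbound 1 (by linarith)
  simp only [add_zero] at h0
  have hint : ∀ r, Integrable (fun ω => Real.exp (2 * l * ∑ j ∈ Finset.range K,
      ∑ i ∈ indexBlock m n (2 * j + r), centredIndicator X x c i ω)) μ := by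
    intro r
    exact integrable_exp_mul_of_abs_le (Finset.measurable_fun_sum _ fun j _ =>
      (measurable_sum_centredIndicator (fun i _ => mem_univ i) x c).mono
        (sigmaGen_le hX univ) le_rfl) (fun ω => (Finset.abs_sum_le_sum_abs _ _).trans
      (Finset.sum_le_sum fun j _ => abs_sum_centredIndicator_le hc0 hc1 x _ ω)) _
  have hint0 := hint 0
  simp only [add_zero] at hint0
  calc ∫ ω, Real.exp (l * ∑ i ∈ Finset.Icc 1 n, centredIndicator X x c i ω) ∂μ
      ≤ ∫ ω, (Real.exp (2 * l * ∑ j ∈ Finset.range K, ∑ i ∈ indexBlock m n (2 * j),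
          centredIndicator X x c i ω) +
        Real.exp (2 * l * ∑ j ∈ Finset.range K, ∑ i ∈ indexBlock m n (2 * j + 1),
          centredIndicator X x c i ω)) / 2 ∂μ := by
        refine integral_mono_of_nonneg (ae_of_all _ fun ω => (Real.exp_pos _).le)
          ((hint0.add (hint 1)).div_const 2) (ae_of_all _ fun ω => ?_)
        beta_reduce
        rw [← hsplit fun i => centredIndicator X x c i ω]
        exact exp_mul_add_le l _ _
    _ ≤ _ := by
        rw [integral_div, integral_add hint0 (hint 1)]
        linarith

end Mixing

/-- **Pointwise empirical distribution bound.** For a φ-mixing sequence with common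
marginal distribution function `F`, for any fixed `x`, any `t > 0`, any `0 < β < 1`
with `m = ⌊n^β⌋`, and any `n ≥ 2`,
`P(|F_n(x) - F(x)| > t) ≤ 2e C₁ exp{-n t² / (2 C₂ (2 + n^β t))}`,
where `C₁ = exp{2e n^{1-β} φ(m)}` and `C₂ = 4[1 + 4 ∑_{i=1}^{2m} φ^{1/2}(i)]`. -/
theorem bahadur_empDF_pointwise {Ω : Type*} [MeasurableSpace Ω] (μ : Measure Ω)
    [IsProbabilityMeasure μ]
    (X : ℕ → Ω → ℝ) (hX : ∀ i, Measurable (X i))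
    (hanti : Antitone (phiCoef X μ))
    (hmix : Tendsto (phiCoef X μ) atTop (nhds 0))
    (F : ℝ → ℝ) (hF : ∀ i, 1 ≤ i → ∀ x, F x = (μ {ω | X i ω ≤ x}).toReal)
    (x : ℝ) (t : ℝ) (ht : 0 < t)
    (β : ℝ) (hβ : 0 < β ∧ β < 1)
    (n : ℕ) (hn : 2 ≤ n)
    (m : ℕ) (hm : m = ⌊(n : ℝ) ^ β⌋₊)
    (C1 : ℝ) (hC1 : C1 = Real.exp (2 * Real.exp 1 * (n : ℝ) ^ (1 - β) * phiCoef X μ m))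
    (C2 : ℝ) (hC2 : C2 = 4 * (1 + 4 * ∑ i ∈ Finset.Icc 1 (2 * m), Real.sqrt (phiCoef X μ i))) :
    (μ {ω | t < |empDF X n ω x - F x|}).toReal ≤
      2 * Real.exp 1 * C1 *
        Real.exp (-(n * t ^ 2) / (2 * C2 * (2 + (n : ℝ) ^ β * t))) := by
  have hc : ∀ i, 1 ≤ i → F x = μ.real {ω | X i ω ≤ x} := fun i hi => hF i hi x
  set c := F x with hcx
  have hc0 : 0 ≤ c := hc 1 le_rfl ▸ measureReal_nonneg
  have hc1 : c ≤ 1 := hc 1 le_rfl ▸ measureReal_le_one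
  have hn1 : (1 : ℝ) ≤ n := by exact_mod_cast (by omega : 1 ≤ n)
  have hn0 : (0 : ℝ) < n := by linarith
  set a := (n : ℝ) ^ β with ha
  have ha1 : 1 ≤ a := Real.one_le_rpow hn1 hβ.1.le
  have hma : (m : ℝ) ≤ a := hm ▸ Nat.floor_le (by linarith)
  have hm1 : 1 ≤ m := hm ▸ Nat.le_floor (by simpa using ha1)
  have hm1' : (1 : ℝ) ≤ m := by exact_mod_cast hm1
  have ham : a ≤ 2 * m := by
    have := Nat.lt_floor_add_one a
    rw [← hm] at this
    linarith
  have hb1 : 1 ≤ (n : ℝ) ^ (1 - β) := Real.one_le_rpow hn1 (by linarith [hβ.2])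
  have hab : a * (n : ℝ) ^ (1 - β) = n := by
    rw [ha, ← Real.rpow_add hn0]
    simp
  set b := (n : ℝ) ^ (1 - β) with hb
  set K := n / (2 * m) + 1 with hKdef
  have hK : n ≤ 2 * K * m := by
    have := Nat.lt_div_mul_add (a := n) (b := 2 * m) (by omega)
    calc n ≤ n / (2 * m) * (2 * m) + 2 * m := this.le
      _ = 2 * K * m := by rw [hKdef]; ring
  have hKb : (K : ℝ) ≤ 2 * b := by
    have h1 : ((n / (2 * m) : ℕ) : ℝ) ≤ (n : ℝ) / ((2 * m : ℕ) : ℝ) := Nat.cast_div_le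
    have h2 : (n : ℝ) / ((2 * m : ℕ) : ℝ) ≤ b := by
      rw [div_le_iff₀ (by push_cast; linarith), ← hab]
      push_cast
      nlinarith
    rw [hKdef]
    push_cast
    linarith
  have hφ := phiCoef_nonneg (X := X) (μ := μ) m
  set D := 1 + 4 * ∑ i ∈ Finset.Icc 1 (2 * m), Real.sqrt (phiCoef X μ i) with hD
  have hD1 : 1 ≤ D := le_add_of_nonneg_right
    (mul_nonneg zero_le_four (Finset.sum_nonneg fun i _ => Real.sqrt_nonneg _))
  clear_value D b K
  set S : Ω → ℝ := fun ω => ∑ i ∈ Finset.Icc 1 n, centredIndicator X x c i ω with hS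
  set q := 2 + a * t with hq
  have hq2 : 2 ≤ q := by nlinarith
  have hDq : 0 < 4 * D * q := mul_pos (by linarith) (by linarith)
  set l := t / (4 * D * q) with hl
  have hlq : l * (4 * D * q) = t := div_mul_cancel₀ _ hDq.ne'
  have hl0 : 0 < l := div_pos ht hDq
  clear_value l q a
  have hlm : 2 * l * m ≤ 1 := by
    have h1 : l * (2 * m) ≤ l * (2 * a) := by gcongr
    have h2 : 2 * (a * t) ≤ 4 * D * q := by nlinarith
    have h3 : l * (2 * a) * t ≤ 1 * t := by
      calc l * (2 * a) * t = l * (2 * (a * t)) := by ring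
        _ ≤ l * (4 * D * q) := by gcongr
        _ = 1 * t := by rw [hlq, one_mul]
    linarith [le_of_mul_le_mul_right h3 ht]
  have htail : ∀ s : ℝ, (s = 1 ∨ s = -1) → μ.real {ω | n * t ≤ s * S ω} ≤
      C1 * Real.exp (-(n * t ^ 2) / (2 * C2 * q)) := by
    intro s hs
    have hs2 : s ^ 2 = 1 := by rcases hs with rfl | rfl <;> norm_num
    have hsabs : |2 * (l * s)| * m ≤ 1 := by
      have : |s| = 1 := by rcases hs with rfl | rfl <;> simp
      rw [abs_mul, abs_mul, this, abs_of_pos hl0]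
      simpa using hlm
    have hmgf := integral_exp_sum_centredIndicator_le hX hc hK hsabs
    have hint : Integrable (fun ω => Real.exp (l * (s * S ω))) μ := by
      simp only [← mul_assoc]
      exact integrable_exp_mul_of_abs_le
        ((measurable_sum_centredIndicator (fun i _ => mem_univ i) x c).mono
          (sigmaGen_le hX univ) le_rfl) (abs_sum_centredIndicator_le hc0 hc1 x _) _
    refine (ProbabilityTheory.measure_ge_le_exp_mul_mgf (n * t) hl0.le hint).trans ?_
    simp only [ProbabilityTheory.mgf, ← mul_assoc]
    refine (mul_le_mul_of_nonneg_left hmgf (Real.exp_pos _).le).trans ?_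
    rw [hC1, ← Real.exp_add, ← Real.exp_add, Real.exp_le_exp, ← hD, mul_pow, hs2]
    have h1 : K * (phiCoef X μ m * Real.exp 1) ≤ 2 * Real.exp 1 * b * phiCoef X μ m := by
      have := mul_le_mul_of_nonneg_right hKb (mul_nonneg hφ (Real.exp_pos 1).le)
      linarith
    have h2 : -(n * t ^ 2) / (2 * C2 * q) = -(l * (n * t) / 2) := by
      have hD0 : D ≠ 0 := by linarith
      have hq0 : q ≠ 0 := by linarith
      rw [hC2, hl]
      field_simp
    have h3 : 4 * l ^ 2 * D ≤ l * t / 2 := by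
      have h4 : 4 * l * D * 2 ≤ t := by
        rw [← hlq]
        nlinarith [mul_pos hl0 (by linarith : 0 < D)]
      nlinarith
    have h5 := mul_le_mul_of_nonneg_right h3 hn0.le
    rw [h2]
    linarith
  have hSdf : ∀ ω, S ω = n * (empDF X n ω x - c) := by
    intro ω
    simp only [hS, centredIndicator, empDF, Finset.sum_sub_distrib, Finset.sum_const,
      Nat.card_Icc, nsmul_eq_mul, mul_sub, add_tsub_cancel_right]
    rw [mul_inv_cancel_left₀ hn0.ne']
  have hsub : {ω | t < |empDF X n ω x - c|} ⊆
      {ω | n * t ≤ 1 * S ω} ∪ {ω | n * t ≤ -1 * S ω} := by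
    intro ω (hω : t < |empDF X n ω x - c|)
    rcases lt_abs.1 hω with h | h
    · left
      change n * t ≤ 1 * S ω
      rw [hSdf, one_mul]
      exact mul_le_mul_of_nonneg_left h.le hn0.le
    · right
      change n * t ≤ -1 * S ω
      rw [hSdf]
      have := mul_le_mul_of_nonneg_left h.le hn0.le
      linarith
  have hfin := (measureReal_mono (μ := μ) hsub).trans (measureReal_union_le _ _)
  have hp := htail 1 (.inl rfl)
  have hmn := htail (-1) (.inr rfl)
  have he : 1 ≤ Real.exp 1 := Real.one_le_exp zero_le_one
  have hC0 : 0 ≤ C1 * Real.exp (-(n * t ^ 2) / (2 * C2 * q)) :=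
    mul_nonneg (hC1 ▸ (Real.exp_pos _).le) (Real.exp_pos _).le
  change μ.real {ω | t < |empDF X n ω x - c|} ≤ _
  linarith [mul_le_mul_of_nonneg_right he hC0]
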